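/- Let f : [0,1] → ℝ be twice continuously differentiable with |f''(x)| ≤ K on [0,1], and let S_n f = Σ_{i=0}^{n−1} c_i φ_i be the n-th partial Fourier sum with respect to the Legendre scaling functions, where c_i = ∫₀¹ f φ_i. Then for n ≥ 2, ‖f − S_n f‖²_{L²[0,1]} ≤ (3K²/8) Σ_{i=n}^∞ 1/(2i−3)⁴. -/

import Mathlib

/-- The Legendre polynomials, via the three-term recurrence. -/
noncomputable def legendreP : ℕ → ℝ → ℝ
  | 0, _ => 1
  | 1, x => x
  | n + 2, x =>
      ((2 * (n : ℝ) + 3) * x * legendreP (n + 1) x - ((n : ℝ) + 1) * legendreP n x) /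
        ((n : ℝ) + 2)

/-- The Legendre scaling functions on `[0,1]`. -/
noncomputable def legendreScaling (i : ℕ) (x : ℝ) : ℝ :=
  Real.sqrt (2 * i + 1) * legendreP i (2 * x - 1)

/-- The `n`-th partial Fourier sum with respect to the Legendre scaling functions. -/
noncomputable def legendrePartialSum (n : ℕ) (f : ℝ → ℝ) (x : ℝ) : ℝ :=
  ∑ i ∈ Finset.range n, (∫ t in (0:ℝ)..1, f t * legendreScaling i t) * legendreScaling i x

lemma legP_rec (n : ℕ) (x : ℝ) : ((n:ℝ) + 2) * legendreP (n + 2) x =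
    (2 * (n : ℝ) + 3) * x * legendreP (n + 1) x - ((n : ℝ) + 1) * legendreP n x := by
  have h : ((n:ℝ) + 2) ≠ 0 := by positivity
  rw [legendreP]
  field_simp

lemma legP_zero (x : ℝ) : legendreP 0 x = 1 := by rw [legendreP]

lemma legP_one (x : ℝ) : legendreP 1 x = x := by rw [legendreP]

lemma legP_diff_aux (n : ℕ) : Differentiable ℝ (legendreP n) ∧
    Differentiable ℝ (legendreP (n + 1)) := by
  induction n with
  | zero =>
    have h0 : legendreP 0 = fun _ => 1 := funext legP_zero
    have h1 : legendreP (0 + 1) = fun x => x := funext legP_one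
    rw [h0, h1]
    constructor <;> fun_prop
  | succ n ih =>
    refine ⟨ih.2, ?_⟩
    have h : legendreP (n + 1 + 1) = fun x => ((2 * (n : ℝ) + 3) * x * legendreP (n + 1) x -
      ((n : ℝ) + 1) * legendreP n x) / ((n : ℝ) + 2) := by
      funext x; rw [legendreP]
    rw [h]
    have h1 := ih.1
    have h2 := ih.2
    fun_prop

lemma legP_diff (n : ℕ) : Differentiable ℝ (legendreP n) := (legP_diff_aux n).1

lemma legP_deriv_rec (n : ℕ) (x : ℝ) : ((n:ℝ) + 2) * deriv (legendreP (n + 2)) x =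
    (2 * (n : ℝ) + 3) * (legendreP (n + 1) x + x * deriv (legendreP (n + 1)) x)
      - ((n : ℝ) + 1) * deriv (legendreP n) x := by
  have e : (fun x => ((n:ℝ) + 2) * legendreP (n + 2) x) = fun x =>
    (2 * (n : ℝ) + 3) * x * legendreP (n + 1) x - ((n : ℝ) + 1) * legendreP n x :=
    funext (legP_rec n)
  have h2 := ((legP_diff (n+2) x).hasDerivAt).const_mul ((n:ℝ) + 2)
  have h1 := (legP_diff (n+1) x).hasDerivAt
  have h0 := ((legP_diff n x).hasDerivAt).const_mul ((n:ℝ) + 1)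
  have h3 := ((((hasDerivAt_id' x).const_mul (2 * (n : ℝ) + 3)).mul h1).sub h0)
  rw [e] at h2
  rw [h2.unique h3]
  ring

lemma legP_bc (n : ℕ) (x : ℝ) :
    deriv (legendreP (n + 1)) x = x * deriv (legendreP n) x + ((n:ℝ) + 1) * legendreP n x ∧
    x * deriv (legendreP (n + 1)) x - deriv (legendreP n) x =
      ((n:ℝ) + 1) * legendreP (n + 1) x := by
  induction n with
  | zero =>
    have h0 : legendreP 0 = fun _ => 1 := funext legP_zero
    have h1 : legendreP (0 + 1) = fun x => x := funext legP_one
    rw [h0, h1]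
    simp
  | succ n ih =>
    obtain ⟨hb, hc⟩ := ih
    have hd := legP_deriv_rec n x
    have hr := legP_rec n x
    have hn : ((n:ℝ) + 2) ≠ 0 := by positivity
    have hB : deriv (legendreP (n + 2)) x =
        x * deriv (legendreP (n + 1)) x + ((n:ℝ) + 2) * legendreP (n + 1) x := by
      apply mul_left_cancel₀ hn
      linear_combination hd + ((n:ℝ) + 1) * hc
    push_cast
    refine ⟨?_, ?_⟩
    · rw [show n + 1 + 1 = n + 2 from rfl, hB]; ring
    · rw [show n + 1 + 1 = n + 2 from rfl]
      linear_combination x * hB + x * hc - hb - hr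

lemma legP_deriv_diff (n : ℕ) (x : ℝ) :
    deriv (legendreP (n + 2)) x - deriv (legendreP n) x =
      (2 * (n:ℝ) + 3) * legendreP (n + 1) x := by
  have h1 := (legP_bc (n + 1) x).1
  have h2 := (legP_bc n x).2
  push_cast at h1
  rw [show n + 1 + 1 = n + 2 from rfl] at h1
  linear_combination h1 + h2

lemma legP_at_one (n : ℕ) : legendreP n 1 = 1 ∧ legendreP (n + 1) 1 = 1 := by
  induction n with
  | zero => exact ⟨legP_zero 1, legP_one 1⟩
  | succ n ih =>
    refine ⟨ih.2, ?_⟩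
    have hn : ((n:ℝ) + 2) ≠ 0 := by positivity
    apply mul_left_cancel₀ hn
    rw [show n + 1 + 1 = n + 2 from rfl, legP_rec, ih.1, ih.2]; ring

lemma legP_at_neg (n : ℕ) : legendreP n (-1) = (-1) ^ n ∧
    legendreP (n + 1) (-1) = (-1) ^ (n + 1) := by
  induction n with
  | zero => exact ⟨by rw [legP_zero]; simp, by rw [legP_one]; simp⟩
  | succ n ih =>
    refine ⟨ih.2, ?_⟩
    have hn : ((n:ℝ) + 2) ≠ 0 := by positivity
    apply mul_left_cancel₀ hn
    rw [show n + 1 + 1 = n + 2 from rfl, legP_rec, ih.1, ih.2]; ring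

/-- Shifted Legendre polynomials. -/
noncomputable def shA (i : ℕ) (x : ℝ) : ℝ := legendreP i (2 * x - 1)

lemma shA_diff (i : ℕ) : Differentiable ℝ (shA i) := by
  have := legP_diff i
  unfold shA
  fun_prop

@[fun_prop]
lemma shA_cont (i : ℕ) : Continuous (shA i) := (shA_diff i).continuous

lemma shA_zero (x : ℝ) : shA 0 x = 1 := legP_zero _
lemma shA_one (x : ℝ) : shA 1 x = 2 * x - 1 := legP_one _

lemma shA_rec (n : ℕ) (x : ℝ) : ((n:ℝ) + 2) * shA (n + 2) x =
    (2 * (n : ℝ) + 3) * (2 * x - 1) * shA (n + 1) x - ((n : ℝ) + 1) * shA n x :=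
  legP_rec n _

/-- Antiderivative of `shA (m+1)` vanishing at the end points. -/
noncomputable def shC (m : ℕ) (x : ℝ) : ℝ := (shA (m + 2) x - shA m x) / (2 * (2 * (m:ℝ) + 3))

lemma shA_hasDeriv (i : ℕ) (x : ℝ) :
    HasDerivAt (shA i) (2 * deriv (legendreP i) (2 * x - 1)) x := by
  have h1 : HasDerivAt (fun x : ℝ => 2 * x - 1) 2 x := by
    simpa using ((hasDerivAt_id' x).const_mul (2:ℝ)).sub_const 1
  have h := ((legP_diff i (2 * x - 1)).hasDerivAt).comp x h1
  rw [mul_comm] at h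
  exact h

lemma shC_hasDeriv (m : ℕ) (x : ℝ) : HasDerivAt (shC m) (shA (m + 1) x) x := by
  have h := ((shA_hasDeriv (m+2) x).sub (shA_hasDeriv m x)).div_const (2 * (2 * (m:ℝ) + 3))
  have e : (2 * deriv (legendreP (m+2)) (2 * x - 1) - 2 * deriv (legendreP m) (2 * x - 1)) /
      (2 * (2 * (m:ℝ) + 3)) = shA (m + 1) x := by
    rw [← mul_sub, legP_deriv_diff, shA]
    field_simp
  rw [e] at h
  exact h

lemma shC_at_zero (m : ℕ) : shC m 0 = 0 := by
  have h : (2 * (0:ℝ) - 1) = -1 := by norm_num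
  simp only [shC, shA, h, (legP_at_neg _).1]
  ring

lemma shC_at_one (m : ℕ) : shC m 1 = 0 := by
  have h : (2 * (1:ℝ) - 1) = 1 := by norm_num
  simp only [shC, shA, h, (legP_at_one _).1]
  ring

@[fun_prop]
lemma shC_cont (m : ℕ) : Continuous (shC m) := by unfold shC; fun_prop

/-- inner product -/
noncomputable def ipr (f g : ℝ → ℝ) : ℝ := ∫ x in (0:ℝ)..1, f x * g x

lemma ipr_comm (f g : ℝ → ℝ) : ipr f g = ipr g f := by
  unfold ipr; congr 1; funext x; ring

lemma ipr_add {f g h : ℝ → ℝ} (hf : Continuous f) (hg : Continuous g) (hh : Continuous h) :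
    ipr f (fun x => g x + h x) = ipr f g + ipr f h := by
  unfold ipr
  have h1 : IntervalIntegrable (fun x => f x * g x) MeasureTheory.volume 0 1 :=
    (hf.mul hg).intervalIntegrable _ _
  have h2 : IntervalIntegrable (fun x => f x * h x) MeasureTheory.volume 0 1 :=
    (hf.mul hh).intervalIntegrable _ _
  rw [← intervalIntegral.integral_add h1 h2]
  congr 1; funext x; ring

lemma ipr_smul (c : ℝ) (f g : ℝ → ℝ) : ipr f (fun x => c * g x) = c * ipr f g := by
  unfold ipr
  rw [← intervalIntegral.integral_const_mul]
  congr 1; funext x; ring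

lemma ipr_lin {f g h : ℝ → ℝ} (a b : ℝ) (hf : Continuous f) (hg : Continuous g)
    (hh : Continuous h) :
    ipr f (fun x => a * g x + b * h x) = a * ipr f g + b * ipr f h := by
  rw [ipr_add hf (by fun_prop) (by fun_prop), ipr_smul, ipr_smul]

lemma ipr_self_nonneg (f : ℝ → ℝ) : 0 ≤ ipr f f := by
  unfold ipr
  apply intervalIntegral.integral_nonneg (by norm_num)
  intro x _
  exact mul_self_nonneg _

lemma ipr_lin_sq {g h : ℝ → ℝ} (a b : ℝ) (hg : Continuous g) (hh : Continuous h) :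
    ipr (fun x => a * g x + b * h x) (fun x => a * g x + b * h x) =
      a ^ 2 * ipr g g + 2 * a * b * ipr g h + b ^ 2 * ipr h h := by
  rw [ipr_lin a b (by fun_prop) hg hh, ipr_comm _ g, ipr_comm _ h, ipr_lin a b hg hg hh,
    ipr_lin a b hh hg hh, ipr_comm h g]
  ring

lemma ipr_cs {g h : ℝ → ℝ} (hg : Continuous g) (hh : Continuous h) (hpos : 0 < ipr h h) :
    (ipr g h) ^ 2 ≤ ipr g g * ipr h h := by
  have h1 := ipr_self_nonneg (fun x => ipr h h * g x + (- ipr g h) * h x)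
  rw [ipr_lin_sq _ _ hg hh] at h1
  have h2 : 0 ≤ ipr h h * (ipr g g * ipr h h - (ipr g h) ^ 2) := by nlinarith
  have := nonneg_of_mul_nonneg_right h2 hpos
  linarith

lemma ipr_zero_succ (n : ℕ) : ipr (shA 0) (shA (n + 1)) = 0 := by
  unfold ipr
  simp only [shA_zero, one_mul]
  rw [intervalIntegral.integral_eq_sub_of_hasDerivAt (fun x _ => shC_hasDeriv n x)
    ((shA_cont _).intervalIntegrable _ _), shC_at_one, shC_at_zero, sub_zero]

lemma ipr_zero_zero : ipr (shA 0) (shA 0) = 1 := by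
  unfold ipr
  simp [shA_zero]

/-- multiplication by `2x-1` -/
lemma ipr_X_succ {f : ℝ → ℝ} (hf : Continuous f) (n : ℕ) :
    (2 * (n:ℝ) + 3) * ipr f (fun x => (2 * x - 1) * shA (n + 1) x) =
      ((n:ℝ) + 2) * ipr f (shA (n + 2)) + ((n:ℝ) + 1) * ipr f (shA n) := by
  rw [← ipr_smul, ← ipr_lin _ _ hf (shA_cont _) (shA_cont _)]
  congr 1; funext x
  linear_combination - shA_rec n x

lemma ipr_X_symm (f g : ℝ → ℝ) : ipr f (fun x => (2 * x - 1) * g x) =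
    ipr g (fun x => (2 * x - 1) * f x) := by
  unfold ipr; congr 1; funext x; ring

lemma ipr_X_zero (f : ℝ → ℝ) : ipr f (fun x => (2 * x - 1) * shA 0 x) = ipr f (shA 1) := by
  congr 1; funext x; rw [shA_zero, shA_one, mul_one]

lemma ortho_aux (m : ℕ) : (∀ n, ipr (shA m) (shA n) = if m = n then 1 / (2 * (m:ℝ) + 1) else 0) ∧
    (∀ n, ipr (shA (m + 1)) (shA n) =
      if m + 1 = n then 1 / (2 * ((m:ℝ) + 1) + 1) else 0) := by
  induction m with
  | zero =>
    have h0 : ∀ n, ipr (shA 0) (shA n) = if 0 = n then 1 / (2 * ((0:ℕ):ℝ) + 1) else 0 := by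
      intro n
      cases n with
      | zero => simp [ipr_zero_zero]
      | succ n => simp [ipr_zero_succ]
    refine ⟨h0, ?_⟩
    intro n
    rw [zero_add, ipr_comm, ← ipr_X_zero, ipr_X_symm]
    cases n with
    | zero => rw [ipr_X_zero, h0]; simp
    | succ n =>
      have h := ipr_X_succ (shA_cont 0) n
      have hn : (2 * (n:ℝ) + 3) ≠ 0 := by positivity
      apply mul_left_cancel₀ hn
      rw [h, h0, h0]
      rcases n with _ | n
      · norm_num
      · simp
  | succ m ih =>
    obtain ⟨ih0, ih1⟩ := ih
    refine ⟨by intro n; rw [ih1 n]; push_cast; rfl, ?_⟩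
    intro n
    have hm : ((m:ℝ) + 2) ≠ 0 := by positivity
    have h := ipr_X_succ (shA_cont n) m
    rw [ipr_X_symm, ipr_comm (shA n) (shA m), ih0, ipr_comm (shA n) (shA (m + 2))] at h
    apply mul_left_cancel₀ hm
    rw [show m + 1 + 1 = m + 2 from rfl]
    rw [eq_comm, ← eq_sub_iff_add_eq] at h
    rw [h]
    clear h
    rcases n with _ | n
    · rw [ipr_X_zero, ih1]
      rcases m with _ | m
      · norm_num
      · simp
    · have h2 := ipr_X_succ (shA_cont (m + 1)) n
      have hn : (2 * (n:ℝ) + 3) ≠ 0 := by positivity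
      apply mul_left_cancel₀ hn
      rw [mul_sub, mul_left_comm, h2, ih1, ih1]
      by_cases e1 : m = n + 1
      · subst e1
        rw [if_pos (by omega), if_neg (by omega), if_pos (by omega), if_neg (by omega)]
        push_cast
        field_simp
        ring
      · by_cases e3 : m + 1 = n
        · subst e3
          rw [if_neg (by omega), if_pos (by omega), if_neg (by omega), if_pos (by omega)]
          push_cast
          field_simp
          ring
        · rw [if_neg (by omega), if_neg (by omega), if_neg (by omega), if_neg (by omega)]
          ring

lemma ortho (m n : ℕ) : ipr (shA m) (shA n) = if m = n then 1 / (2 * (m:ℝ) + 1) else 0 :=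
  (ortho_aux m).1 n

/-- Remainder of the `N`-th partial sum. -/
noncomputable def remE (f : ℝ → ℝ) (N : ℕ) (x : ℝ) : ℝ :=
  f x - ∑ i ∈ Finset.range N, (2 * (i:ℝ) + 1) * ipr f (shA i) * shA i x

lemma remE_eq (f : ℝ → ℝ) (N : ℕ) (x : ℝ) : f x - legendrePartialSum N f x = remE f N x := by
  unfold remE legendrePartialSum
  congr 1
  apply Finset.sum_congr rfl
  intro i _
  have h : (∫ t in (0:ℝ)..1, f t * legendreScaling i t) =
      Real.sqrt (2 * i + 1) * ipr f (shA i) := by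
    rw [← ipr_smul]; rfl
  have hs : Real.sqrt (2 * (i:ℝ) + 1) * Real.sqrt (2 * (i:ℝ) + 1) = 2 * (i:ℝ) + 1 :=
    Real.mul_self_sqrt (by positivity)
  rw [h]
  unfold legendreScaling
  change _ * (_ * shA i x) = _
  linear_combination (ipr f (shA i) * shA i x) * hs

lemma remE_cont {f : ℝ → ℝ} (hf : Continuous f) (N : ℕ) : Continuous (remE f N) := by
  unfold remE
  fun_prop

lemma remE_succ (f : ℝ → ℝ) (N : ℕ) (x : ℝ) :
    remE f (N + 1) x = 1 * remE f N x + (-((2 * (N:ℝ) + 1) * ipr f (shA N))) * shA N x := by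
  unfold remE
  rw [Finset.sum_range_succ]
  ring

lemma remE_ipr {f : ℝ → ℝ} (hf : Continuous f) (N j : ℕ) :
    ipr (remE f N) (shA j) = if j < N then 0 else ipr f (shA j) := by
  induction N with
  | zero => 
    simp only [not_lt_zero, if_false]
    congr 1; funext x; simp [remE]
  | succ N ih =>
    have e : remE f (N + 1) = fun x => 1 * remE f N x +
      (-((2 * (N:ℝ) + 1) * ipr f (shA N))) * shA N x := funext (remE_succ f N)
    rw [e, ipr_comm, ipr_lin _ _ (shA_cont j) (remE_cont hf N) (shA_cont N), ipr_comm, ih, ortho]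
    by_cases h : j = N
    · subst h
      simp
      field_simp
      ring
    · by_cases h2 : j < N
      · rw [if_pos h2, if_neg h, if_pos (by omega)]; ring
      · rw [if_neg h2, if_neg h, if_neg (by omega)]; ring

lemma remE_sq_succ {f : ℝ → ℝ} (hf : Continuous f) (N : ℕ) :
    ipr (remE f N) (remE f N) =
      (2 * (N:ℝ) + 1) * ipr f (shA N) ^ 2 + ipr (remE f (N + 1)) (remE f (N + 1)) := by
  have e : remE f (N + 1) = fun x => 1 * remE f N x +
      (-((2 * (N:ℝ) + 1) * ipr f (shA N))) * shA N x := funext (remE_succ f N)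
  rw [e, ipr_lin_sq _ _ (remE_cont hf N) (shA_cont N), remE_ipr hf, ortho]
  simp
  field_simp
  ring

lemma remE_sq_add {f : ℝ → ℝ} (hf : Continuous f) (n M : ℕ) :
    ipr (remE f n) (remE f n) =
      ∑ k ∈ Finset.range M, (2 * ((n:ℝ) + k) + 1) * ipr f (shA (n + k)) ^ 2 +
        ipr (remE f (n + M)) (remE f (n + M)) := by
  induction M with
  | zero => simp
  | succ M ih =>
    rw [ih, Finset.sum_range_succ, remE_sq_succ hf (n + M)]
    push_cast
    rw [← add_assoc n M 1]
    ring

lemma remE_self {f : ℝ → ℝ} (hf : Continuous f) (N : ℕ) :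
    ipr (remE f N) (remE f N) = ipr (remE f N) f := by
  have key : ∀ M, M ≤ N → ipr (remE f N) (remE f M) = ipr (remE f N) f := by
    intro M
    induction M with
    | zero => intro _; congr 1; funext x; simp [remE]
    | succ M ih =>
      intro h
      have e : remE f (M + 1) = fun x => 1 * remE f M x +
        (-((2 * (M:ℝ) + 1) * ipr f (shA M))) * shA M x := funext (remE_succ f M)
      rw [e, ipr_lin _ _ (remE_cont hf N) (remE_cont hf M) (shA_cont M), remE_ipr hf,
        if_pos (by omega), ih (by omega)]
      ring
  exact key N le_rfl

/-- eventual orthogonality -/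
def EvO (f g : ℝ → ℝ) : Prop :=
  Continuous g ∧ ∃ N0 : ℕ, ∀ N, N0 ≤ N → ipr (remE f N) g = 0

lemma EvO.lin {f g h : ℝ → ℝ} (hf : Continuous f) (a b : ℝ) (hg : EvO f g) (hh : EvO f h) :
    EvO f (fun x => a * g x + b * h x) := by
  obtain ⟨cg, N1, h1⟩ := hg
  obtain ⟨ch, N2, h2⟩ := hh
  refine ⟨by fun_prop, max N1 N2, fun N hN => ?_⟩
  rw [ipr_lin _ _ (remE_cont hf N) cg ch, h1 N (le_trans (le_max_left _ _) hN),
    h2 N (le_trans (le_max_right _ _) hN)]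
  ring

lemma EvO_shA {f : ℝ → ℝ} (hf : Continuous f) (i : ℕ) : EvO f (shA i) :=
  ⟨shA_cont i, i + 1, fun N hN => by rw [remE_ipr hf, if_pos (by omega)]⟩

lemma EvO_poly {f : ℝ → ℝ} (hf : Continuous f) (p : Polynomial ℝ) :
    ∀ i, EvO f (fun x => p.eval x * shA i x) := by
  induction p using Polynomial.induction_on with
  | C a =>
    intro i
    have := EvO.lin hf a 0 (EvO_shA hf i) (EvO_shA hf i)
    convert this using 2 with x
    simp
  | add p q hp hq =>
    intro i
    have := EvO.lin hf 1 1 (hp i) (hq i)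
    convert this using 2 with x
    simp; ring
  | monomial n a ih =>
    intro i
    rcases i with _ | i
    · have := EvO.lin hf (1/2) (1/2) (ih 1) (ih 0)
      convert this using 2 with x
      simp [shA_zero, shA_one]; ring
    · have h1 := EvO.lin hf (((i:ℝ) + 2) / (2 * (i:ℝ) + 3)) (((i:ℝ) + 1) / (2 * (i:ℝ) + 3))
        (ih (i + 2)) (ih i)
      have := EvO.lin hf (1/2) (1/2) h1 (ih (i + 1))
      convert this using 2 with x
      have hr := shA_rec i x
      have hn : (2 * (i:ℝ) + 3) ≠ 0 := by positivity
      simp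
      field_simp
      linear_combination (-(a * x ^ n)) * hr

lemma remE_small {f : ℝ → ℝ} (hf : Continuous f) {ε : ℝ} (hε : 0 < ε) :
    ∃ N0 : ℕ, ∀ N, N0 ≤ N → ipr (remE f N) (remE f N) ≤ ε ^ 2 := by
  obtain ⟨p, hp⟩ := exists_polynomial_near_of_continuousOn 0 1 f hf.continuousOn ε hε
  have hpo := EvO_poly hf p 0
  simp only [shA_zero, mul_one] at hpo
  obtain ⟨cp, N0, h0⟩ := hpo
  refine ⟨N0, fun N hN => ?_⟩
  have cE := remE_cont hf N
  have cd : Continuous (fun x => 1 * f x + (-1) * p.eval x) := by fun_prop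
  have h1 : ipr (remE f N) (remE f N) = ipr (remE f N) (fun x => 1 * f x + (-1) * p.eval x) := by
    rw [ipr_lin _ _ cE hf cp, h0 N hN, ← remE_self hf]; ring
  have h2 := ipr_self_nonneg (fun x => 1 * remE f N x + (-1) * (1 * f x + (-1) * p.eval x))
  rw [ipr_lin_sq _ _ cE cd, ← h1] at h2
  have h3 : ipr (fun x => 1 * f x + (-1) * p.eval x) (fun x => 1 * f x + (-1) * p.eval x)
      ≤ ε ^ 2 := by
    have h4 : (∫ x in (0:ℝ)..1, (1 * f x + (-1) * p.eval x) * (1 * f x + (-1) * p.eval x)) ≤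
        ∫ x in (0:ℝ)..1, ε ^ 2 := by
      apply intervalIntegral.integral_mono_on (by norm_num)
      · exact (cd.mul cd).intervalIntegrable _ _
      · exact continuous_const.intervalIntegrable _ _
      · intro x hx
        have := hp x hx
        rw [abs_lt] at this
        nlinarith
    simpa [ipr] using h4
  linarith

lemma ibp {g g1 : ℝ → ℝ} (hg : ∀ x, HasDerivAt g (g1 x) x) (hg1 : Continuous g1) (m : ℕ) :
    ipr g (shA (m + 1)) = - ipr g1 (shC m) := by
  unfold ipr
  rw [intervalIntegral.integral_mul_deriv_eq_deriv_mul (fun x _ => hg x)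
    (fun x _ => shC_hasDeriv m x) (hg1.intervalIntegrable _ _)
    ((shA_cont _).intervalIntegrable _ _), shC_at_one, shC_at_zero]
  ring

/-- second antiderivative -/
noncomputable def shB (j : ℕ) (x : ℝ) : ℝ :=
  (1 / (2 * (2 * (j:ℝ) + 5))) * shC (j + 2) x + (-(1 / (2 * (2 * (j:ℝ) + 5)))) * shC j x

lemma shC_lin (j : ℕ) : shC j = fun x => (1 / (2 * (2 * (j:ℝ) + 3))) * shA (j + 2) x +
    (-(1 / (2 * (2 * (j:ℝ) + 3)))) * shA j x := by
  funext x
  unfold shC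
  field_simp
  ring

lemma ibp2 {g g1 g2 : ℝ → ℝ} (hg : ∀ x, HasDerivAt g (g1 x) x)
    (hg1 : ∀ x, HasDerivAt g1 (g2 x) x) (hg2 : Continuous g2) (j : ℕ) :
    ipr g (shA (j + 2)) = ipr g2 (shB j) := by
  have c1 : Continuous g1 := continuous_iff_continuousAt.2 fun x => (hg1 x).continuousAt
  rw [show j + 2 = (j + 1) + 1 from rfl, ibp hg c1, shC_lin,
    ipr_lin _ _ c1 (shA_cont _) (shA_cont _), show j + 1 + 2 = (j + 2) + 1 from rfl,
    ibp hg1 hg2, ibp hg1 hg2]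
  unfold shB
  rw [ipr_lin _ _ hg2 (shC_cont _) (shC_cont _)]
  push_cast
  field_simp
  ring

lemma shB_sq (j : ℕ) : ipr (shB j) (shB j) = 1 / (16 * (2 * (j:ℝ) + 5) ^ 2) *
    (1 / ((2 * (j:ℝ) + 7) ^ 2 * (2 * (j:ℝ) + 9)) +
     (1 / (2 * (j:ℝ) + 7) + 1 / (2 * (j:ℝ) + 3)) ^ 2 / (2 * (j:ℝ) + 5) +
     1 / ((2 * (j:ℝ) + 3) ^ 2 * (2 * (j:ℝ) + 1))) := by
  have cc : ∀ m, ipr (shC m) (shC m) = _ := fun m => by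
    rw [shC_lin, ipr_lin_sq _ _ (shA_cont _) (shA_cont _), ortho, ortho, ortho,
      if_pos rfl, if_neg (by omega), if_pos rfl]
  have cd : ipr (shC (j + 2)) (shC j) = (1 / (2 * (2 * (j:ℝ) + 3))) *
      ((-(1 / (2 * (2 * ((j + 2 : ℕ):ℝ) + 3)))) * (1 / (2 * ((j + 2 : ℕ):ℝ) + 1))) := by
    rw [shC_lin j, ipr_lin _ _ (shC_cont _) (shA_cont _) (shA_cont _), ipr_comm,
      ipr_comm _ (shA j), shC_lin (j + 2),
      ipr_lin _ _ (shA_cont _) (shA_cont _) (shA_cont _),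
      ipr_lin _ _ (shA_cont _) (shA_cont _) (shA_cont _), ortho, ortho, ortho, ortho,
      if_neg (by omega), if_pos rfl, if_neg (by omega), if_neg (by omega)]
    ring
  unfold shB
  rw [ipr_lin_sq _ _ (shC_cont _) (shC_cont _), cc, cc, cd]
  push_cast
  have e9 : 2 * ((j:ℝ) + 2 + 2) + 1 = 2 * (j:ℝ) + 9 := by ring
  have e7 : 2 * ((j:ℝ) + 2) + 3 = 2 * (j:ℝ) + 7 := by ring
  have e5 : 2 * ((j:ℝ) + 2) + 1 = 2 * (j:ℝ) + 5 := by ring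
  rw [e9, e7, e5]
  have p1 : (2 * (j:ℝ) + 1) ≠ 0 := by positivity
  have p3 : (2 * (j:ℝ) + 3) ≠ 0 := by positivity
  have p5 : (2 * (j:ℝ) + 5) ≠ 0 := by positivity
  have p7 : (2 * (j:ℝ) + 7) ≠ 0 := by positivity
  have p9 : (2 * (j:ℝ) + 9) ≠ 0 := by positivity
  field_simp
  ring

lemma shB_bound (j : ℕ) : (2 * (j:ℝ) + 5) * ipr (shB j) (shB j) ≤ 3 / 8 / (2 * (j:ℝ) + 1) ^ 4 := by
  rw [shB_sq]
  have hj : (0:ℝ) ≤ j := Nat.cast_nonneg j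
  have p1 : (0:ℝ) < (2 * (j:ℝ) + 1) := by positivity
  set a := 2 * (j:ℝ) + 1 with ha
  have e3 : 2 * (j:ℝ) + 3 = a + 2 := by rw [ha]; ring
  have e5 : 2 * (j:ℝ) + 5 = a + 4 := by rw [ha]; ring
  have e7 : 2 * (j:ℝ) + 7 = a + 6 := by rw [ha]; ring
  have e9 : 2 * (j:ℝ) + 9 = a + 8 := by rw [ha]; ring
  rw [e3, e5, e7, e9]
  have h1 : 1 / ((a + 6) ^ 2 * (a + 8)) ≤ 1 / a ^ 3 := by
    apply one_div_le_one_div_of_le (by positivity)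
    nlinarith [sq_nonneg a, mul_pos p1 p1]
  have h3 : 1 / ((a + 2) ^ 2 * a) ≤ 1 / a ^ 3 := by
    apply one_div_le_one_div_of_le (by positivity)
    nlinarith [sq_nonneg a, mul_pos p1 p1]
  have h2 : (1 / (a + 6) + 1 / (a + 2)) ^ 2 / (a + 4) ≤ 4 / a ^ 3 := by
    have : (1 / (a + 6) + 1 / (a + 2)) ^ 2 / (a + 4) ≤ (1 / a + 1 / a) ^ 2 / a := by
      gcongr <;> linarith
    refine this.trans (le_of_eq ?_)
    field_simp
    norm_num
  calc (a + 4) * (1 / (16 * (a + 4) ^ 2) * (1 / ((a + 6) ^ 2 * (a + 8)) +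
        (1 / (a + 6) + 1 / (a + 2)) ^ 2 / (a + 4) + 1 / ((a + 2) ^ 2 * a)))
      ≤ (a + 4) * (1 / (16 * (a + 4) ^ 2) * (1 / a ^ 3 + 4 / a ^ 3 + 1 / a ^ 3)) := by gcongr
    _ = 3 / 8 / (a ^ 3 * (a + 4)) := by field_simp; norm_num
    _ ≤ 3 / 8 / (a ^ 3 * a) := by gcongr; linarith
    _ = 3 / 8 / a ^ 4 := by ring

lemma coeff_bound {g g1 g2 : ℝ → ℝ} {K : ℝ} (hg : ∀ x, HasDerivAt g (g1 x) x)
    (hg1 : ∀ x, HasDerivAt g1 (g2 x) x) (hg2 : Continuous g2)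
    (hK : ∀ x ∈ Set.Icc (0:ℝ) 1, |g2 x| ≤ K) (j : ℕ) :
    (2 * (j:ℝ) + 5) * ipr g (shA (j + 2)) ^ 2 ≤ 3 * K ^ 2 / 8 * (1 / (2 * (j:ℝ) + 1) ^ 4) := by
  have hpos : 0 < ipr (shB j) (shB j) := by rw [shB_sq]; positivity
  have cB : Continuous (shB j) := by unfold shB; fun_prop
  have h1 := ipr_cs hg2 cB hpos
  have h3 : ipr g2 g2 ≤ K ^ 2 := by
    have h4 : (∫ x in (0:ℝ)..1, g2 x * g2 x) ≤ ∫ x in (0:ℝ)..1, K ^ 2 := by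
      apply intervalIntegral.integral_mono_on (by norm_num)
      · exact (hg2.mul hg2).intervalIntegrable _ _
      · exact continuous_const.intervalIntegrable _ _
      · intro x hx
        have := hK x hx
        rw [abs_le] at this
        nlinarith
    simpa [ipr] using h4
  rw [ibp2 hg hg1 hg2]
  have hb := shB_bound j
  calc (2 * (j:ℝ) + 5) * ipr g2 (shB j) ^ 2
      ≤ (2 * (j:ℝ) + 5) * (K ^ 2 * ipr (shB j) (shB j)) := by
        gcongr
        exact h1.trans (by gcongr)
    _ = K ^ 2 * ((2 * (j:ℝ) + 5) * ipr (shB j) (shB j)) := by ring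
    _ ≤ K ^ 2 * (3 / 8 / (2 * (j:ℝ) + 1) ^ 4) := by gcongr
    _ = _ := by ring

/-- `L²` error of the `n`-th partial Fourier–Legendre sum of a `C²` function. -/
theorem legendre_partial_sum_L2_error (f : ℝ → ℝ) (K : ℝ)
    (hf : ContDiff ℝ 2 f)
    (hK : ∀ x ∈ Set.Icc (0:ℝ) 1, |iteratedDeriv 2 f x| ≤ K)
    (n : ℕ) (hn : 2 ≤ n) :
    ∫ x in (0:ℝ)..1, (f x - legendrePartialSum n f x) ^ 2 ≤
      (3 * K ^ 2 / 8) * ∑' k : ℕ, 1 / (2 * ((n : ℝ) + (k : ℝ)) - 3) ^ 4 := by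
  have hc : Continuous f := hf.continuous
  have hd : ∀ x, HasDerivAt f (deriv f x) x := fun x =>
    (hf.differentiable (by norm_num) x).hasDerivAt
  have hd1 : ContDiff ℝ 1 (deriv f) := by
    have : ContDiff ℝ (1 + 1) f := by
      convert hf using 1
      norm_num
    exact (contDiff_succ_iff_deriv.1 this).2.2
  have hdd : ∀ x, HasDerivAt (deriv f) (iteratedDeriv 2 f x) x := fun x => by
    have h := (hd1.differentiable (by norm_num) x).hasDerivAt
    rw [iteratedDeriv_succ, iteratedDeriv_one]
    exact h
  have hc2 : Continuous (iteratedDeriv 2 f) := hf.continuous_iteratedDeriv 2 (by norm_num)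
  have hI : ∫ x in (0:ℝ)..1, (f x - legendrePartialSum n f x) ^ 2 =
      ipr (remE f n) (remE f n) := by
    unfold ipr
    congr 1; funext x; rw [remE_eq]; ring
  rw [hI]
  obtain ⟨m, rfl⟩ := Nat.exists_eq_add_of_le' hn
  have hs : Summable (fun k : ℕ => 1 / (2 * (((m + 2 : ℕ) : ℝ) + (k : ℝ)) - 3) ^ 4) := by
    have h4 : Summable (fun k : ℕ => 1 / ((k + 1 : ℕ) : ℝ) ^ 4) :=
      (summable_nat_add_iff 1).2 (Real.summable_one_div_nat_pow.2 (by norm_num : 1 < 4))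
    refine Summable.of_nonneg_of_le (fun k => by positivity) (fun k => ?_) h4
    apply one_div_le_one_div_of_le (by positivity)
    push_cast
    have : (0:ℝ) ≤ m := Nat.cast_nonneg m
    have : (0:ℝ) ≤ k := Nat.cast_nonneg k
    gcongr
    linarith
  have hterm : ∀ k : ℕ, (2 * (((m + 2 : ℕ):ℝ) + k) + 1) * ipr f (shA (m + 2 + k)) ^ 2 ≤
      3 * K ^ 2 / 8 * (1 / (2 * (((m + 2 : ℕ) : ℝ) + (k : ℝ)) - 3) ^ 4) := fun k => by
    have h := coeff_bound hd hdd hc2 hK (m + k)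
    have e1 : 2 * (((m + 2 : ℕ):ℝ) + k) + 1 = 2 * ((m + k : ℕ) : ℝ) + 5 := by push_cast; ring
    have e2 : 2 * (((m + 2 : ℕ):ℝ) + k) - 3 = 2 * ((m + k : ℕ) : ℝ) + 1 := by push_cast; ring
    rw [e1, e2, show m + 2 + k = m + k + 2 by omega]
    exact h
  apply le_of_forall_pos_le_add
  intro δ hδ
  obtain ⟨N0, hN0⟩ := remE_small hc (Real.sqrt_pos.2 hδ)
  rw [Real.sq_sqrt hδ.le] at hN0
  rw [remE_sq_add hc (m + 2) N0]
  refine add_le_add ?_ (hN0 _ (by omega))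
  refine (Finset.sum_le_sum fun k _ => hterm k).trans ?_
  rw [← Finset.mul_sum]
  apply mul_le_mul_of_nonneg_left _ (by positivity)
  exact hs.sum_le_tsum _ (fun k _ => by positivity)
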